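/- arXiv:1408.0974 — 2 statements merged into one kernel-verified Lean document; each statement's English description precedes it below -/
import Mathlib

section
/- (Theorem 2.3, case (iii): forward-backward splitting) Let Φ : H → ℝ be convex and differentiable with ∇Φ Lipschitz of constant L_Φ, let Φ₂ : H → ℝ ∪ {+∞} be proper, lower-semicontinuous and convex, and assume S = argmin(Φ + Φ₂) is nonempty. Let (λ_n) be a positive sequence with ∑ λ_n = +∞ and ∑ L_Φ λ_n² < +∞, and let (x_n) satisfy: x₁ ∈ H and, for each n ≥ 1, (x_n − x_{n+1})/λ_n − ∇Φ(x_n) ∈ ∂Φ₂(x_{n+1}). Then (x_n) converges weakly to a point of S as n → ∞, and lim_{n→∞} (Φ + Φ₂)(x_n) = min(Φ + Φ₂). -/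
open Filter Topology
open scoped RealInnerProductSpace

variable {H : Type*} [NormedAddCommGroup H] [InnerProductSpace ℝ H] [CompleteSpace H]

/-- A set-valued operator `A : H → Set H` is monotone. -/
def MonotoneOp (A : H → Set H) : Prop :=
  ∀ x y x' y', x' ∈ A x → y' ∈ A y → 0 ≤ ⟪x' - y', x - y⟫

/-- A set-valued operator is maximal monotone: it is monotone and its graph is not
properly contained in the graph of any other monotone operator. -/
def MaxMonotoneOp (A : H → Set H) : Prop :=
  MonotoneOp A ∧ ∀ B : H → Set H, MonotoneOp B → (∀ x, A x ⊆ B x) → B = A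

/-- The (outward) normal cone to a set `C` at `x`: empty when `x ∉ C`. -/
def nCone (C : Set H) (x : H) : Set H :=
  {p | x ∈ C ∧ ∀ c ∈ C, ⟪p, c - x⟫ ≤ 0}

/-- Subdifferential of an extended-real-valued function. -/
def ESubdiff (F : H → EReal) (x : H) : Set H :=
  {p | ∀ y, F x + ((⟪p, y - x⟫ : ℝ) : EReal) ≤ F y}

/-- Fenchel conjugate of an extended-real-valued function. -/
noncomputable def fenchelConj (F : H → EReal) (p : H) : EReal :=
  ⨆ y, (((⟪y, p⟫ : ℝ) : EReal) - F y)

/-- Support function of a set. -/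
noncomputable def suppFun (C : Set H) (p : H) : EReal :=
  ⨆ c : C, ((⟪p, (c : H)⟫ : ℝ) : EReal)

/-- `F : H → EReal` is proper (not identically `+∞`, never `−∞`),
lower-semicontinuous and convex. -/
def ProperLscConvexE (F : H → EReal) : Prop :=
  (∃ x, F x ≠ ⊤) ∧ (∀ x, F x ≠ ⊥) ∧ LowerSemicontinuous F ∧
    ∀ x y (t : ℝ), 0 ≤ t → t ≤ 1 →
      F (t • x + (1 - t) • y) ≤ ((t : ℝ) : EReal) * F x + (((1 - t : ℝ)) : EReal) * F y

/-- Weak convergence of a sequence in a Hilbert space. -/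
def WeakConv (x : ℕ → H) (p : H) : Prop :=
  ∀ y : H, Tendsto (fun n => ⟪x n, y⟫) atTop (𝓝 ⟪p, y⟫)

/-- A weak cluster point: weak limit of some subsequence. -/
def WeakClusterPt (x : ℕ → H) (p : H) : Prop :=
  ∃ φ : ℕ → ℕ, StrictMono φ ∧ WeakConv (x ∘ φ) p

/-- Boundedly inf-compact function: intersections of balls and sublevel sets are
relatively compact. -/
def BddInfCompact (F : H → EReal) : Prop :=
  ∀ R M : ℝ, 0 ≤ R → IsCompact (closure {p : H | ‖p‖ ≤ R ∧ F p ≤ (M : EReal)})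

/-- The data of the (SFBP) algorithm together with hypotheses (H₀). -/
structure SFBP (H : Type*) [NormedAddCommGroup H] [InnerProductSpace ℝ H]
    [CompleteSpace H] where
  /-- the maximal monotone operator -/
  A : H → Set H
  /-- the smooth potential -/
  Φ : H → ℝ
  /-- its gradient -/
  Φ' : H → H
  /-- the smooth penalization potential -/
  Ψ₁ : H → ℝ
  /-- its gradient -/
  Ψ₁' : H → H
  /-- the nonsmooth penalization potential -/
  Ψ₂ : H → EReal
  /-- the constraint set -/
  C : Set H
  /-- the step sizes -/
  lam : ℕ → ℝ
  /-- the penalization parameters -/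
  beta : ℕ → ℝ
  /-- Lipschitz constant of ∇Φ -/
  LΦ : ℝ
  /-- Lipschitz constant of ∇Ψ₁ -/
  LΨ₁ : ℝ
  /-- the sequence generated by the algorithm -/
  x : ℕ → H
  convΦ : ConvexOn ℝ Set.univ Φ
  gradΦ : ∀ p, HasGradientAt Φ (Φ' p) p
  lipΦ : ∀ p q, ‖Φ' p - Φ' q‖ ≤ LΦ * ‖p - q‖
  convΨ₁ : ConvexOn ℝ Set.univ Ψ₁
  gradΨ₁ : ∀ p, HasGradientAt Ψ₁ (Ψ₁' p) p
  lipΨ₁ : ∀ p q, ‖Ψ₁' p - Ψ₁' q‖ ≤ LΨ₁ * ‖p - q‖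
  properΨ₂ : ProperLscConvexE Ψ₂
  Ψ₁nonneg : ∀ p, 0 ≤ Ψ₁ p
  Ψ₂nonneg : ∀ p, (0 : EReal) ≤ Ψ₂ p
  minΨ₁ : ∃ p, Ψ₁ p = 0
  minΨ₂ : ∃ p, Ψ₂ p = 0
  Cdef : C = {p | ∀ q, Ψ₁ p ≤ Ψ₁ q} ∩ {p | ∀ q, Ψ₂ p ≤ Ψ₂ q}
  Cne : C.Nonempty
  maxmonA : MaxMonotoneOp A
  maxmonT : MaxMonotoneOp
    (fun p => {w | ∃ za ∈ A p, ∃ v ∈ nCone C p, w = za + Φ' p + v})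
  Sne : ∃ p, ∃ za ∈ A p, ∃ v ∈ nCone C p, za + Φ' p + v = 0
  lamPos : ∀ n, 0 < lam n
  betaPos : ∀ n, 0 < beta n
  lamDiv : Tendsto (fun N => ∑ k ∈ Finset.range N, lam k) atTop atTop
  sumSq : Summable fun n => LΦ * lam n ^ 2
  limsupCond : ∃ γ : ℝ, γ < 2 ∧ ∀ᶠ n in atTop, LΨ₁ * (lam n * beta n) ≤ γ
  keyCond : ∀ z : H, (∃ u, z ∈ nCone C u) →
    ∃ M : ℝ, ∀ N : ℕ, ∑ n ∈ Finset.range N,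
      (((lam n * beta n : ℝ)) : EReal) *
        (fenchelConj (fun q => ((Ψ₁ q : ℝ) : EReal) + Ψ₂ q) ((beta n)⁻¹ • z)
          - suppFun C ((beta n)⁻¹ • z)) ≤ (M : EReal)
  algo : ∀ n, ∃ a ∈ A (x (n + 1)), ∃ w ∈ ESubdiff Ψ₂ (x (n + 1)),
    x n - x (n + 1) = lam n • (Φ' (x n) + beta n • Ψ₁' (x n) + a + beta n • w)

/-- The solution set `S = (A + ∇Φ + N_C)⁻¹(0)`. -/
def SFBP.S (d : SFBP H) : Set H :=
  {p | ∃ za ∈ d.A p, ∃ v ∈ nCone d.C p, za + d.Φ' p + v = 0}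

lemma fb_grad_ineq (Φ : H → ℝ) (Φ' : H → H)
    (hconv : ConvexOn ℝ Set.univ Φ) (hgrad : ∀ p, HasGradientAt Φ (Φ' p) p) (p q : H) :
    Φ p + ⟪Φ' p, q - p⟫ ≤ Φ q := by
  have h1 : ConvexOn ℝ Set.univ (Φ ∘ (AffineMap.lineMap p q : ℝ →ᵃ[ℝ] H)) := by
    simpa using hconv.comp_affineMap (AffineMap.lineMap p q : ℝ →ᵃ[ℝ] H)
  have h2 : HasDerivAt (Φ ∘ (AffineMap.lineMap p q : ℝ →ᵃ[ℝ] H)) ⟪Φ' p, q - p⟫ 0 := by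
    have ha : HasDerivAt (AffineMap.lineMap p q : ℝ → H) (q - p) 0 := AffineMap.hasDerivAt_lineMap
    have hb := (hgrad p).hasFDerivAt
    have hc : HasFDerivAt Φ (InnerProductSpace.toDual ℝ H (Φ' p))
      ((AffineMap.lineMap p q : ℝ → H) 0) := by simpa using hb
    simpa using hc.comp_hasDerivAt (0 : ℝ) ha
  have h3 := h1.le_slope_of_hasDerivAt (Set.mem_univ 0) (Set.mem_univ 1) zero_lt_one h2
  simp [slope] at h3
  linarith

lemma fb_weak_limit (x : ℕ → H) (R : ℝ) (hR : ∀ n, ‖x n‖ ≤ R) (U : Ultrafilter ℕ) :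
    ∃ p : H, ∀ y, Tendsto (fun n => ⟪x n, y⟫) U (𝓝 ⟪p, y⟫) := by
  have hc := WeakDual.isCompact_closedBall (0 : StrongDual ℝ H) R
  let g : ℕ → WeakDual ℝ H := fun n => StrongDual.toWeakDual (InnerProductSpace.toDual ℝ H (x n))
  obtain ⟨l, -, hl⟩ := hc.ultrafilter_le_nhds (U.map g) (by
    simp only [le_principal_iff]
    refine Filter.mem_map.2 (Filter.univ_mem' fun n => ?_)
    simp [g, hR n])
  refine ⟨(InnerProductSpace.toDual ℝ H).symm (WeakDual.toStrongDual l), fun y => ?_⟩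
  have h1 : Tendsto g U (𝓝 l) := hl
  have h2 := ((WeakDual.eval_continuous (𝕜 := ℝ) (E := H) y).tendsto l).comp h1
  have h3 : ⟪(InnerProductSpace.toDual ℝ H).symm (WeakDual.toStrongDual l), y⟫ = l y := by
    rw [InnerProductSpace.toDual_symm_apply]; rfl
  rw [h3]
  exact h2

lemma fb_closed_convex (C : Set H) (hC : Convex ℝ C) (hcl : IsClosed C) (x : ℕ → H)
    (U : Ultrafilter ℕ) (p : H) (hp : ∀ y, Tendsto (fun n => ⟪x n, y⟫) U (𝓝 ⟪p, y⟫))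
    (hx : ∀ᶠ n in (U : Filter ℕ), x n ∈ C) : p ∈ C := by
  by_contra hpC
  obtain ⟨f, u, h1, h2⟩ := geometric_hahn_banach_closed_point hC hcl hpC
  have h3 := hp ((InnerProductSpace.toDual ℝ H).symm f)
  have he : ∀ v, ⟪v, (InnerProductSpace.toDual ℝ H).symm f⟫ = f v := fun v => by
    rw [real_inner_comm, InnerProductSpace.toDual_symm_apply]
  simp only [he] at h3
  have := le_of_tendsto h3 (hx.mono fun n hn => (h1 _ hn).le)
  linarith

lemma fb_sum (a b lam : ℕ → ℝ) (N : ℕ)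
    (ha : ∀ n, 0 ≤ a n) (hb : ∀ n, 0 ≤ b n) (hlam : ∀ n, 0 < lam n)
    (hdiv : Tendsto (fun N => ∑ k ∈ Finset.range N, lam k) atTop atTop)
    (hanti : ∀ n ≥ N, a (n + 1) ≤ a n)
    (hab : ∀ n ≥ N, lam n * a n ≤ b n - b (n + 1)) : Tendsto a atTop (𝓝 0) := by
  set Λ : ℕ → ℝ := fun N => ∑ k ∈ Finset.range N, lam k with hΛ
  have hs : ∀ n, Λ (n + 1) = Λ n + lam n := fun n => Finset.sum_range_succ _ _
  have key : ∀ M ≥ N, 0 ≤ Λ M - Λ N ∧ a M * (Λ M - Λ N) ≤ b N - b M := by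
    intro M hM
    induction M, hM using Nat.le_induction with
    | base => simp
    | succ M hM ih =>
      obtain ⟨i1, i2⟩ := ih
      have l := hlam M
      rw [hs]
      have hp : 0 ≤ Λ M + lam M - Λ N := by linarith
      refine ⟨hp, ?_⟩
      have := mul_le_mul_of_nonneg_right (hanti M hM) hp
      have := hab M hM
      nlinarith
  have ht : Tendsto (fun M => Λ M - Λ N) atTop atTop := by
    simpa [sub_eq_add_neg] using tendsto_atTop_add_const_right atTop (-Λ N) hdiv
  have hz : Tendsto (fun M => b N / (Λ M - Λ N)) atTop (𝓝 0) := ht.const_div_atTop _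
  refine squeeze_zero' (Eventually.of_forall ha) ?_ hz
  filter_upwards [eventually_ge_atTop N, ht.eventually_gt_atTop 0] with M hM hpos
  rw [le_div_iff₀ hpos]
  have := (key M hM).2
  have := hb M
  linarith

lemma fb_opial (x : ℕ → H) (S : Set H) (hne : S.Nonempty)
    (hlim : ∀ z ∈ S, ∃ l, Tendsto (fun n => ‖x n - z‖ ^ 2) atTop (𝓝 l))
    (hcl : ∀ (U : Ultrafilter ℕ) (p : H), (U : Filter ℕ) ≤ atTop →
      (∀ y, Tendsto (fun n => ⟪x n, y⟫) U (𝓝 ⟪p, y⟫)) → p ∈ S) :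
    ∃ p ∈ S, WeakConv x p := by
  obtain ⟨z, hz⟩ := hne
  obtain ⟨l, hl⟩ := hlim z hz
  obtain ⟨R, hR⟩ : ∃ R, ∀ n, ‖x n‖ ≤ R := by
    obtain ⟨B, hB⟩ := hl.bddAbove_range
    refine ⟨B + 1 + ‖z‖, fun n => ?_⟩
    have h1 : ‖x n - z‖ ^ 2 ≤ B := hB ⟨n, rfl⟩
    have h2 : ‖x n‖ ≤ ‖x n - z‖ + ‖z‖ := by simpa using norm_add_le (x n - z) z
    nlinarith [sq_nonneg (‖x n - z‖ - 1)]
  have huniq : ∀ (U V : Ultrafilter ℕ) (p q : H), (U : Filter ℕ) ≤ atTop →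
      (V : Filter ℕ) ≤ atTop →
      (∀ y, Tendsto (fun n => ⟪x n, y⟫) U (𝓝 ⟪p, y⟫)) →
      (∀ y, Tendsto (fun n => ⟪x n, y⟫) V (𝓝 ⟪q, y⟫)) → p = q := by
    intro U V p q hU hV hp hq
    obtain ⟨l1, h1⟩ := hlim p (hcl U p hU hp)
    obtain ⟨l2, h2⟩ := hlim q (hcl V q hV hq)
    have h3 : Tendsto (fun n => ⟪x n, p - q⟫) atTop
        (𝓝 ((l2 - l1 + ‖p‖ ^ 2 - ‖q‖ ^ 2) / 2)) := by
      have := (((h2.sub h1).add_const (‖p‖ ^ 2)).sub_const (‖q‖ ^ 2)).div_const 2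
      refine this.congr fun n => ?_
      rw [norm_sub_sq_real, norm_sub_sq_real, inner_sub_right]
      ring
    have e1 := tendsto_nhds_unique (hp (p - q)) (h3.mono_left hU)
    have e2 := tendsto_nhds_unique (hq (p - q)) (h3.mono_left hV)
    have : ⟪p - q, p - q⟫ = (0 : ℝ) := by rw [inner_sub_left]; linarith
    exact sub_eq_zero.1 (inner_self_eq_zero.1 this)
  let U₀ : Ultrafilter ℕ := Ultrafilter.of atTop
  have hU₀ : (U₀ : Filter ℕ) ≤ atTop := Ultrafilter.of_le _
  obtain ⟨p, hp⟩ := fb_weak_limit x R hR U₀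
  refine ⟨p, hcl U₀ p hU₀ hp, fun y => ?_⟩
  rw [tendsto_iff_ultrafilter]
  intro V hV
  obtain ⟨q, hq⟩ := fb_weak_limit x R hR V
  rw [huniq U₀ V p q hU₀ hV hp hq]
  exact hq y

/-- Sublevel sets of the sum are closed and convex. -/
lemma fb_sublevel (Φ : H → ℝ) (hconv : ConvexOn ℝ Set.univ Φ) (hcont : Continuous Φ)
    (Φ₂ : H → EReal) (hΦ₂ : ProperLscConvexE Φ₂) (c : ℝ) :
    Convex ℝ {p : H | ((Φ p : ℝ) : EReal) + Φ₂ p ≤ c} ∧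
      IsClosed {p : H | ((Φ p : ℝ) : EReal) + Φ₂ p ≤ c} := by
  obtain ⟨-, hbot, hlsc, hcv⟩ := hΦ₂
  have hiff : ∀ p, ((Φ p : ℝ) : EReal) + Φ₂ p ≤ c ↔ Φ₂ p ≤ ((c - Φ p : ℝ) : EReal) := by
    intro p
    rcases h : Φ₂ p with _ | _ | r
    · exact absurd h (hbot p)
    · rw [show ((some none : EReal)) = (⊤ : EReal) from rfl, EReal.coe_add_top, top_le_iff, top_le_iff]
      exact iff_of_false (EReal.coe_ne_top _) (EReal.coe_ne_top _)
    · rw [show ((some (some r) : EReal)) = ((r : ℝ) : EReal) from rfl]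
      norm_cast
      constructor <;> intro h <;> linarith
  constructor
  · intro p hp q hq s t hs ht hst
    simp only [Set.mem_ofPred_eq, hiff] at hp hq ⊢
    have ht' : t = 1 - s := by linarith
    subst ht'
    have h1 := hcv p q s hs (by linarith)
    have h2 := hconv.2 (Set.mem_univ p) (Set.mem_univ q) hs ht hst
    refine h1.trans ?_
    have e1 : (s : EReal) * Φ₂ p ≤ (s : EReal) * ((c - Φ p : ℝ) : EReal) :=
      mul_le_mul_of_nonneg_left hp (by exact_mod_cast hs)
    have e2 : ((1 - s : ℝ) : EReal) * Φ₂ q ≤ ((1 - s : ℝ) : EReal) * ((c - Φ q : ℝ) : EReal) :=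
      mul_le_mul_of_nonneg_left hq (by exact_mod_cast ht)
    refine (add_le_add e1 e2).trans ?_
    rw [← EReal.coe_mul, ← EReal.coe_mul, ← EReal.coe_add, EReal.coe_le_coe_iff]
    simp only [smul_eq_mul] at h2
    linarith
  · have hl : LowerSemicontinuous (fun p => ((Φ p : ℝ) : EReal) + Φ₂ p) := by
      refine LowerSemicontinuous.add' 
        (continuous_coe_real_ereal.comp hcont).lowerSemicontinuous hlsc fun p => ?_
      exact EReal.continuousAt_add (Or.inl (EReal.coe_ne_top _)) (Or.inl (EReal.coe_ne_bot _))
    exact hl.isClosed_preimage (c : EReal)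

/-- **Theorem 2.3, case (iii): forward-backward splitting.** -/
theorem forward_backward_weak (Φ : H → ℝ) (Φ' : H → H) (LΦ : ℝ)
    (hconv : ConvexOn ℝ Set.univ Φ) (hgrad : ∀ p, HasGradientAt Φ (Φ' p) p)
    (hlip : ∀ p q, ‖Φ' p - Φ' q‖ ≤ LΦ * ‖p - q‖)
    (Φ₂ : H → EReal) (hΦ₂ : ProperLscConvexE Φ₂)
    (hSne : {p : H | ∀ q, ((Φ p : ℝ) : EReal) + Φ₂ p ≤ ((Φ q : ℝ) : EReal) + Φ₂ q}.Nonempty)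
    (lam : ℕ → ℝ) (hlam : ∀ n, 0 < lam n)
    (hdiv : Filter.Tendsto (fun N => ∑ k ∈ Finset.range N, lam k) Filter.atTop Filter.atTop)
    (hsum : Summable fun n => LΦ * lam n ^ 2)
    (x : ℕ → H)
    (halgo : ∀ n, ∃ w ∈ ESubdiff Φ₂ (x (n + 1)),
      x n - x (n + 1) = lam n • (Φ' (x n) + w)) :
    ∃ p, (∀ q, ((Φ p : ℝ) : EReal) + Φ₂ p ≤ ((Φ q : ℝ) : EReal) + Φ₂ q) ∧ WeakConv x p ∧
      Filter.Tendsto (fun n => ((Φ (x n) : ℝ) : EReal) + Φ₂ (x n)) Filter.atTop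
        (𝓝 (⨅ q, (((Φ q : ℝ) : EReal) + Φ₂ q))) := by
  have hbot := hΦ₂.2.1
  have hcont : Continuous Φ :=
    continuous_iff_continuousAt.2 fun p => (hgrad p).hasFDerivAt.continuousAt
  have hgi := fb_grad_ineq Φ Φ' hconv hgrad
  -- replace the Lipschitz constant by a nonnegative one
  obtain ⟨L, hL0, hL, hLsum⟩ : ∃ L : ℝ, 0 ≤ L ∧ (∀ p q, ‖Φ' p - Φ' q‖ ≤ L * ‖p - q‖) ∧
      Summable fun n => L * lam n ^ 2 := by
    rcases le_total 0 LΦ with h | h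
    · exact ⟨LΦ, h, hlip, hsum⟩
    · refine ⟨0, le_rfl, fun p q => (hlip p q).trans ?_, by simp⟩
      exact mul_le_mul_of_nonneg_right h (norm_nonneg _)
  have hstep : ∀ᶠ n in atTop, 2 * L * lam n ≤ 1 := by
    have h1 : Tendsto (fun n => L * lam n ^ 2) atTop (𝓝 0) := hLsum.tendsto_atTop_zero
    have h2 : Tendsto (fun n => 4 * L * (L * lam n ^ 2)) atTop (𝓝 0) := by
      simpa using h1.const_mul (4 * L)
    filter_upwards [h2.eventually_lt_const zero_lt_one] with n hn
    have := hlam n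
    nlinarith [sq_nonneg (2 * L * lam n - 1)]
  obtain ⟨N, hN⟩ := eventually_atTop.1 hstep
  obtain ⟨z, hz⟩ := hSne
  -- finiteness
  have hfin : ∀ p, (∀ q, ((Φ p : ℝ) : EReal) + Φ₂ p ≤ ((Φ q : ℝ) : EReal) + Φ₂ q) →
      Φ₂ p ≠ ⊤ := by
    intro p hp htop
    obtain ⟨q, hq⟩ := hΦ₂.1
    have := hp q
    rw [htop, EReal.coe_add_top, top_le_iff] at this
    exact EReal.add_ne_top (EReal.coe_ne_top _) hq this
  have hxfin : ∀ n, Φ₂ (x (n + 1)) ≠ ⊤ := by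
    intro n htop
    obtain ⟨w, hw, -⟩ := halgo n
    have := hw z
    rw [htop, EReal.top_add_coe, top_le_iff] at this
    exact hfin z hz this
  set f : H → ℝ := fun p => (Φ₂ p).toReal with hf
  have hfc : ∀ p, Φ₂ p ≠ ⊤ → Φ₂ p = (f p : EReal) := fun p hp =>
    (EReal.coe_toReal hp (hbot p)).symm
  -- key inequality
  have key : ∀ n q, Φ₂ q ≠ ⊤ →
      2 * lam n * ((Φ (x (n + 1)) + f (x (n + 1))) - (Φ q + f q)) ≤
        ‖x n - q‖ ^ 2 - ‖x (n + 1) - q‖ ^ 2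
          - (1 - 2 * L * lam n) * ‖x n - x (n + 1)‖ ^ 2 := by
    intro n q hq
    obtain ⟨w, hw, hx⟩ := halgo n
    have h1 := hw q
    rw [hfc _ (hxfin n), hfc q hq] at h1
    have h1 : f (x (n + 1)) + ⟪w, q - x (n + 1)⟫ ≤ f q := by exact_mod_cast h1
    have h2 := hgi (x n) q
    have h3 := hgi (x (n + 1)) (x n)
    have h4 : ⟪Φ' (x n) - Φ' (x (n + 1)), x n - x (n + 1)⟫ ≤ L * ‖x n - x (n + 1)‖ ^ 2 := by
      refine (real_inner_le_norm _ _).trans ?_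
      have := mul_le_mul_of_nonneg_right (hL (x n) (x (n + 1))) (norm_nonneg (x n - x (n + 1)))
      linarith
    have h5 : lam n * ⟪Φ' (x n) + w, x (n + 1) - q⟫ = ⟪x n - x (n + 1), x (n + 1) - q⟫ := by
      rw [hx, real_inner_smul_left]
    have h6 : ‖x n - q‖ ^ 2 = ‖x n - x (n + 1)‖ ^ 2
        + 2 * ⟪x n - x (n + 1), x (n + 1) - q⟫ + ‖x (n + 1) - q‖ ^ 2 := by
      rw [← norm_add_sq_real]; simp
    have h7 : (Φ (x (n + 1)) + f (x (n + 1))) - (Φ q + f q) ≤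
        ⟪Φ' (x n) + w, x (n + 1) - q⟫ + L * ‖x n - x (n + 1)‖ ^ 2 := by
      simp only [inner_add_left, inner_sub_left, inner_sub_right] at *
      linarith
    have h8 := mul_le_mul_of_nonneg_left h7 (hlam n).le
    rw [h6]
    linarith
  -- minimal value
  set m : ℝ := Φ z + f z with hm
  have hzm : ((Φ z : ℝ) : EReal) + Φ₂ z = (m : EReal) := by
    rw [hfc z (hfin z hz), hm, EReal.coe_add]
  have hFx : ∀ n, ((Φ (x (n + 1)) : ℝ) : EReal) + Φ₂ (x (n + 1)) =
      ((Φ (x (n + 1)) + f (x (n + 1)) : ℝ) : EReal) := by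
    intro n; rw [hfc _ (hxfin n), EReal.coe_add]
  have hmle : ∀ n, m ≤ Φ (x (n + 1)) + f (x (n + 1)) := by
    intro n
    have := hz (x (n + 1))
    rw [hzm, hFx] at this
    exact_mod_cast this
  have hSm : ∀ p, (∀ q, ((Φ p : ℝ) : EReal) + Φ₂ p ≤ ((Φ q : ℝ) : EReal) + Φ₂ q) →
      Φ p + f p = m := by
    intro p hp
    have := le_antisymm (hp z) (hz p)
    rw [hzm, hfc p (hfin p hp), ← EReal.coe_add] at this
    exact_mod_cast this
  have hlamF : ∀ p, (∀ q, ((Φ p : ℝ) : EReal) + Φ₂ p ≤ ((Φ q : ℝ) : EReal) + Φ₂ q) →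
      ∀ n ≥ N, 2 * lam n * ((Φ (x (n + 1)) + f (x (n + 1))) - m) ≤
        ‖x n - p‖ ^ 2 - ‖x (n + 1) - p‖ ^ 2 := by
    intro p hp n hn
    have h1 := key n p (hfin p hp)
    rw [hSm p hp] at h1
    have := mul_nonneg (sub_nonneg.2 (hN n hn)) (sq_nonneg ‖x n - x (n + 1)‖)
    linarith
  -- convergence of values
  have hval : Tendsto (fun n => Φ (x (n + 1)) + f (x (n + 1))) atTop (𝓝 m) := by
    have h0 : Tendsto (fun n => (Φ (x (n + 1)) + f (x (n + 1))) - m) atTop (𝓝 0) := by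
      refine fb_sum _ (fun n => ‖x n - z‖ ^ 2) lam N (fun n => sub_nonneg.2 (hmle n))
        (fun n => sq_nonneg _) hlam hdiv ?_ ?_
      · intro n hn
        have h1 := key (n + 1) (x (n + 1)) (hxfin n)
        rw [sub_self, norm_zero, norm_sub_rev (x (n + 1 + 1))] at h1
        have h2 := mul_nonneg (sub_nonneg.2 (hN (n + 1) (by omega)))
          (sq_nonneg ‖x (n + 1) - x (n + 1 + 1)‖)
        have h3 := sq_nonneg ‖x (n + 1) - x (n + 1 + 1)‖
        by_contra hcon
        have h4 := mul_pos (mul_pos two_pos (hlam (n + 1))) (sub_pos.2 (not_le.1 hcon))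
        linarith
      · intro n hn
        have h1 := hlamF z hz n hn
        have := mul_nonneg (hlam n).le (sub_nonneg.2 (hmle n))
        linarith
    simpa using h0.add_const m
  have hinf : (⨅ q, (((Φ q : ℝ) : EReal) + Φ₂ q)) = (m : EReal) := by
    rw [← hzm]
    exact le_antisymm (iInf_le _ z) (le_iInf hz)
  obtain ⟨p, hp, hwp⟩ := fb_opial x
    {p : H | ∀ q, ((Φ p : ℝ) : EReal) + Φ₂ p ≤ ((Φ q : ℝ) : EReal) + Φ₂ q} ⟨z, hz⟩
    (by
      intro p hp
      have hanti : Antitone fun n => ‖x (n + N) - p‖ ^ 2 := by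
        refine antitone_nat_of_succ_le fun n => ?_
        have h1 := hlamF p hp (n + N) (by omega)
        have h2 := mul_nonneg (mul_pos two_pos (hlam (n + N))).le (sub_nonneg.2 (hmle (n + N)))
        rw [show n + 1 + N = n + N + 1 by omega]
        linarith
      have hbd : BddBelow (Set.range fun n => ‖x (n + N) - p‖ ^ 2) :=
        ⟨0, by rintro _ ⟨n, rfl⟩; exact sq_nonneg _⟩
      exact ⟨_, (tendsto_add_atTop_iff_nat N).1 (tendsto_atTop_ciInf hanti hbd)⟩)
    (by
      intro U p hU hp q
      refine le_trans ?_ (hz q)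
      rw [hzm]
      refine EReal.le_of_forall_lt_iff_le.1 fun c hc => ?_
      have hc' : m < c := by exact_mod_cast hc
      obtain ⟨s1, s2⟩ := fb_sublevel Φ hconv hcont Φ₂ hΦ₂ c
      refine fb_closed_convex _ s1 s2 x U p hp (hU ?_)
      have h1 : ∀ᶠ n in atTop, x (n + 1) ∈ {p : H | ((Φ p : ℝ) : EReal) + Φ₂ p ≤ c} := by
        filter_upwards [hval.eventually_lt_const hc'] with n hn
        rw [hFx]
        exact_mod_cast hn.le
      obtain ⟨K, hK⟩ := eventually_atTop.1 h1
      refine mem_atTop_sets.2 ⟨K + 1, fun n hn => ?_⟩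
      obtain ⟨k, rfl⟩ : ∃ k, n = k + 1 := ⟨n - 1, by omega⟩
      exact hK k (by omega))
  refine ⟨p, hp, hwp, ?_⟩
  rw [hinf]
  refine (tendsto_add_atTop_iff_nat 1).1 ?_
  simp only [hFx]
  exact (continuous_coe_real_ereal.tendsto m).comp hval
end

section
/- (Lemma 5.2, key estimate) Assume hypotheses (H₀). There exist constants a, b, c, d, e > 0 such that for every u ∈ C ∩ dom A, every z ∈ A u, every v ∈ N_C(u), and w = z + ∇Φ(u) + v, the following inequality holds for all sufficiently large n: [1 − a L_Φ λ_n²]‖x_{n+1} − u‖² − ‖x_n − u‖² + b‖x_{n+1} − x_n‖² + c λ_n ‖∇Φ(x_{n+1}) − ∇Φ(u)‖² + (d/2) λ_n β_n (Ψ₁ + Ψ₂)(x_{n+1}) + e λ_n β_n ‖∇Ψ₁(x_n)‖² ≤ (d/2) λ_n β_n [(Ψ₁+Ψ₂)*(4v/(dβ_n)) − σ_C(4v/(dβ_n))] + 2 λ_n ⟨w, u − x_{n+1}⟩. -/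
open Filter Topology
open scoped RealInnerProductSpace

variable {H : Type*} [NormedAddCommGroup H] [InnerProductSpace ℝ H] [CompleteSpace H]

theorem aux_line_deriv {f : H → ℝ} {f' : H → H} (hg : ∀ p, HasGradientAt f (f' p) p) (x h : H)
    (t : ℝ) : HasDerivAt (fun s : ℝ => f (x + s • h)) ⟪f' (x + t • h), h⟫ t := by
  have h1 : HasFDerivAt f (InnerProductSpace.toDual ℝ H (f' (x + t • h))) (x + t • h) := hg _
  have h2 : HasDerivAt (fun s : ℝ => x + s • h) h t := by
    simpa using ((hasDerivAt_id t).smul_const h).const_add x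
  have h3 := h1.comp_hasDerivAt t h2
  rw [InnerProductSpace.toDual_apply_apply] at h3
  exact h3

theorem aux_grad_ineq {f : H → ℝ} {f' : H → H} (hc : ConvexOn ℝ Set.univ f)
    (hg : ∀ p, HasGradientAt f (f' p) p) (x y : H) : f x + ⟪f' x, y - x⟫ ≤ f y := by
  have hd := aux_line_deriv hg x (y - x) 0
  have hcv : ConvexOn ℝ Set.univ (fun s : ℝ => f (x + s • (y - x))) := by
    have := hc.comp_affineMap (AffineMap.lineMap x y : ℝ →ᵃ[ℝ] H)
    simp only [Set.preimage_univ] at this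
    have e : (fun s : ℝ => f (x + s • (y - x))) = f ∘ (AffineMap.lineMap x y : ℝ →ᵃ[ℝ] H) := by
      funext s
      simp [AffineMap.lineMap_apply, add_comm]
    rw [e]
    exact this
  have := hcv.le_slope_of_hasDerivAt (Set.mem_univ _) (Set.mem_univ _) (zero_lt_one) hd
  simp [slope_def_field] at this
  linarith

theorem aux_descent {f : H → ℝ} {f' : H → H} {L : ℝ}
    (hg : ∀ p, HasGradientAt f (f' p) p) (hL : ∀ p q, ‖f' p - f' q‖ ≤ L * ‖p - q‖) (x y : H) :
    f y ≤ f x + ⟪f' x, y - x⟫ + L / 2 * ‖y - x‖ ^ 2 := by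
  set h := y - x with hh
  have hd : ∀ t : ℝ, HasDerivAt (fun s : ℝ => f (x + s • h) - s * ⟪f' x, h⟫ - s ^ 2 * (L / 2 * ‖h‖ ^ 2))
      (⟪f' (x + t • h), h⟫ - ⟪f' x, h⟫ - 2 * t * (L / 2 * ‖h‖ ^ 2)) t := by
    intro t
    have h1 := aux_line_deriv hg x h t
    have h2 := (hasDerivAt_id t).mul_const ⟪f' x, h⟫
    have h3 := ((hasDerivAt_id t).pow 2).mul_const (L / 2 * ‖h‖ ^ 2)
    have h4 := (h1.sub h2).sub h3
    simp only [id, one_mul] at h4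
    refine HasDerivAt.congr_deriv h4 ?_
    norm_num
  have anti : AntitoneOn (fun s : ℝ => f (x + s • h) - s * ⟪f' x, h⟫ - s ^ 2 * (L / 2 * ‖h‖ ^ 2))
      (Set.Ici 0) := by
    apply antitoneOn_of_deriv_nonpos (convex_Ici 0)
    · exact fun t _ => (hd t).continuousAt.continuousWithinAt
    · exact fun t _ => (hd t).differentiableAt.differentiableWithinAt
    · intro t ht
      rw [interior_Ici, Set.mem_Ioi] at ht
      rw [(hd t).deriv, ← inner_sub_left]
      have h1 := real_inner_le_norm (f' (x + t • h) - f' x) h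
      have h2 := hL (x + t • h) x
      rw [add_sub_cancel_left, norm_smul, Real.norm_eq_abs, abs_of_pos ht] at h2
      have h3 := mul_le_mul_of_nonneg_right h2 (norm_nonneg h)
      nlinarith
  have := anti (Set.mem_Ici.2 le_rfl) (Set.mem_Ici.2 zero_le_one) zero_le_one
  simp [hh] at this
  simp only [hh]
  linarith

theorem aux_cocoercive_half {f : H → ℝ} {f' : H → H} {L : ℝ} (hL0 : 0 < L)
    (hc : ConvexOn ℝ Set.univ f)
    (hg : ∀ p, HasGradientAt f (f' p) p) (hL : ∀ p q, ‖f' p - f' q‖ ≤ L * ‖p - q‖) (x u : H) :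
    f u + ⟪f' u, x - u⟫ + 1 / (2 * L) * ‖f' x - f' u‖ ^ 2 ≤ f x := by
  set g := f' x - f' u with hgdef
  have h1 := aux_grad_ineq hc hg u (x - (1 / L) • g)
  have h2 := aux_descent hg hL x (x - (1 / L) • g)
  have e1 : x - (1 / L) • g - u = (x - u) - (1 / L) • g := by abel
  have e2 : x - (1 / L) • g - x = - ((1 / L) • g) := by abel
  rw [e1, inner_sub_right, real_inner_smul_right] at h1
  rw [e2, inner_neg_right, real_inner_smul_right, norm_neg, norm_smul, Real.norm_eq_abs,
    abs_of_pos (by positivity)] at h2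
  have h3 : ⟪f' x, g⟫ - ⟪f' u, g⟫ = ‖g‖ ^ 2 := by
    rw [← inner_sub_left, ← hgdef, real_inner_self_eq_norm_sq]
  have h4 : L / 2 * (1 / L * ‖g‖) ^ 2 = 1 / (2 * L) * ‖g‖ ^ 2 := by field_simp
  have h5 : 1 / L * ⟪f' x, g⟫ - 1 / L * ⟪f' u, g⟫ = 2 * (1 / (2 * L) * ‖g‖ ^ 2) := by
    rw [← mul_sub, h3]; field_simp
  linarith

theorem aux_cocoercive {f : H → ℝ} {f' : H → H} {L : ℝ} (hL0 : 0 < L)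
    (hc : ConvexOn ℝ Set.univ f)
    (hg : ∀ p, HasGradientAt f (f' p) p) (hL : ∀ p q, ‖f' p - f' q‖ ≤ L * ‖p - q‖) (x u : H) :
    1 / L * ‖f' x - f' u‖ ^ 2 ≤ ⟪f' x - f' u, x - u⟫ := by
  have h1 := aux_cocoercive_half hL0 hc hg hL x u
  have h2 := aux_cocoercive_half hL0 hc hg hL u x
  rw [norm_sub_rev (f' u), ← neg_sub x u, inner_neg_right] at h2
  rw [inner_sub_left]
  have : 1 / L * ‖f' x - f' u‖ ^ 2 = 2 * (1 / (2 * L) * ‖f' x - f' u‖ ^ 2) := by field_simp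
  linarith

theorem aux_const {f' : H → H} {L : ℝ} (hL0 : L ≤ 0)
    (hL : ∀ p q, ‖f' p - f' q‖ ≤ L * ‖p - q‖) (x u : H) : f' x = f' u := by
  have := hL x u
  have h2 : L * ‖x - u‖ ≤ 0 := mul_nonpos_of_nonpos_of_nonneg hL0 (norm_nonneg _)
  exact sub_eq_zero.1 (norm_le_zero_iff.1 (this.trans h2))

theorem aux_phi {f : H → ℝ} {f' : H → H} {L : ℝ} (hc : ConvexOn ℝ Set.univ f)
    (hg : ∀ p, HasGradientAt f (f' p) p) (hL : ∀ p q, ‖f' p - f' q‖ ≤ L * ‖p - q‖)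
    {η : ℝ} (hη : 0 < η) : ∃ a > (0:ℝ), ∃ c > (0:ℝ), ∀ x y u : H, ∀ l : ℝ, 0 < l →
      c * l * ‖f' y - f' u‖ ^ 2 - η * ‖y - x‖ ^ 2 - a * L * l ^ 2 * ‖y - u‖ ^ 2
        ≤ 2 * l * ⟪f' x - f' u, y - u⟫ := by
  rcases le_or_gt L 0 with h0 | h0
  · refine ⟨1, one_pos, 1, one_pos, fun x y u l hl => ?_⟩
    have h1 : 0 ≤ L * ‖y - u‖ := (norm_nonneg _).trans (hL y u)
    rw [aux_const h0 hL y u, aux_const h0 hL x u]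
    have h2 : 0 ≤ l ^ 2 * ‖y - u‖ * (L * ‖y - u‖) := by positivity
    have h3 : 0 ≤ η * ‖y - x‖ ^ 2 := by positivity
    simp
    nlinarith
  · refine ⟨L / η, by positivity, 2 / L, by positivity, fun x y u l hl => ?_⟩
    have h1 := aux_cocoercive h0 hc hg hL y u
    have h2 : ⟪f' x - f' u, y - u⟫ = ⟪f' y - f' u, y - u⟫ - ⟪f' y - f' x, y - u⟫ := by
      rw [← inner_sub_left]; congr 1; abel
    have h3 := (real_inner_le_norm (f' y - f' x) (y - u)).trans
      (mul_le_mul_of_nonneg_right (hL y x) (norm_nonneg _))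
    have h4 : 2 * l * (L * ‖y - x‖ * ‖y - u‖) ≤ η * ‖y - x‖ ^ 2 + L / η * L * l ^ 2 * ‖y - u‖ ^ 2 := by
      have : 0 ≤ η * (‖y - x‖ - L * l / η * ‖y - u‖) ^ 2 := by positivity
      have e : η * (‖y - x‖ - L * l / η * ‖y - u‖) ^ 2 = η * ‖y - x‖ ^ 2 +
        L / η * L * l ^ 2 * ‖y - u‖ ^ 2 - 2 * l * (L * ‖y - x‖ * ‖y - u‖) := by
        field_simp; ring
      linarith
    have h5 := mul_le_mul_of_nonneg_left h1 (by positivity : 0 ≤ 2 * l)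
    have h6 := mul_le_mul_of_nonneg_left h3 (by positivity : 0 ≤ 2 * l)
    have e : 2 / L * l * ‖f' y - f' u‖ ^ 2 = 2 * l * (1 / L * ‖f' y - f' u‖ ^ 2) := by ring
    rw [h2, e]
    linarith

theorem aux_psi {f : H → ℝ} {f' : H → H} {L γ : ℝ} (hc : ConvexOn ℝ Set.univ f)
    (hg : ∀ p, HasGradientAt f (f' p) p) (hL : ∀ p q, ‖f' p - f' q‖ ≤ L * ‖p - q‖)
    (hγ : γ < 2) (hmin : ∃ p, f p = 0) (hnn : ∀ p, 0 ≤ f p) :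
    ∃ θ > (0:ℝ), θ ≤ 1 ∧ ∃ e > (0:ℝ), ∃ κ < (1:ℝ), ∀ x y u : H, ∀ m : ℝ, 0 < m → L * m ≤ γ →
      f u = 0 →
      2 * θ * m * f y + e * m * ‖f' x‖ ^ 2 - κ * ‖y - x‖ ^ 2 ≤ 2 * m * ⟪f' x, y - u⟫ := by
  have hz : ∀ u, f u = 0 → f' u = 0 := by
    intro u hu
    have h1 : IsLocalMin f u := Filter.Eventually.of_forall (fun q => by rw [hu]; exact hnn q)
    have h2 := h1.hasFDerivAt_eq_zero (hg u).hasFDerivAt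
    simpa using h2
  obtain ⟨p, hp⟩ := hmin
  rcases le_or_gt L 0 with h0 | h0
  · have hx : ∀ x, f' x = 0 := fun x => (aux_const h0 hL x p).trans (hz p hp)
    have hf : ∀ x, f x = 0 := by
      intro x
      have := aux_grad_ineq hc hg x p
      rw [hx, inner_zero_left, hp] at this
      linarith [hnn x]
    refine ⟨1, one_pos, le_rfl, 1, one_pos, 0, one_pos, fun x y u m hm _ _ => ?_⟩
    rw [hx, hf]; simp
  · obtain ⟨γ', hγγ, hγ1, hγ2⟩ : ∃ γ', γ ≤ γ' ∧ 1 ≤ γ' ∧ γ' < 2 :=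
      ⟨max γ 1, le_max_left _ _, le_max_right _ _, max_lt hγ (by norm_num)⟩
    obtain ⟨α, hα⟩ : ∃ α, α = (2 + γ') / 4 := ⟨_, rfl⟩
    obtain ⟨k, hk⟩ : ∃ k, k = γ' / (2 * α) := ⟨_, rfl⟩
    have hα0 : 0 < α := by linarith
    have hα1 : α < 1 := by linarith
    have hk0 : 0 < k := by rw [hk]; positivity
    have hk1 : k < 1 := by rw [hk, div_lt_one (by positivity)]; linarith
    obtain ⟨θ, hθ⟩ : ∃ θ, θ = (1 - k) / 4 := ⟨_, rfl⟩
    have hθ0 : 0 < θ := by linarith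
    have hθ1 : θ < 1 := by linarith
    refine ⟨θ, hθ0, hθ1.le, (1 - θ) * (2 * (1 - α) / L), ?_, (1 + k) / 2, by linarith,
      fun x y u m hm hLm hu => ?_⟩
    · have : 0 < 1 - θ := by linarith
      have : 0 < 1 - α := by linarith
      positivity
    have hsplit : ⟪f' x, y - u⟫ = ⟪f' x, y - x⟫ + ⟪f' x, x - u⟫ := by
      rw [← inner_add_right]; congr 1; abel
    have hN : 0 ≤ ‖y - x‖ ^ 2 := by positivity
    -- option 1
    have o1 : 2 * m * f y - γ' * ‖y - x‖ ^ 2 ≤ 2 * m * ⟪f' x, y - u⟫ := by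
      have h1 := aux_descent hg hL x y
      have h2 := aux_grad_ineq hc hg x u
      rw [hu, ← neg_sub x u, inner_neg_right] at h2
      have h3 : f y - L / 2 * ‖y - x‖ ^ 2 ≤ ⟪f' x, y - u⟫ := by rw [hsplit]; linarith
      have h4 := mul_le_mul_of_nonneg_left h3 (by positivity : 0 ≤ 2 * m)
      have h5 := mul_le_mul_of_nonneg_right (hLm.trans hγγ) hN
      nlinarith
    -- option 2
    have o2 : 2 * (1 - α) / L * m * ‖f' x‖ ^ 2 - k * ‖y - x‖ ^ 2 ≤ 2 * m * ⟪f' x, y - u⟫ := by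
      have h1 := aux_cocoercive h0 hc hg hL x u
      rw [hz u hu, sub_zero] at h1
      have h2 : -(‖f' x‖ * ‖y - x‖) ≤ ⟪f' x, y - x⟫ := by
        have := abs_real_inner_le_norm (f' x) (y - x)
        exact (abs_le.1 this).1
      have h3 : ‖f' x‖ * ‖y - x‖ ≤ α / L * ‖f' x‖ ^ 2 + L / (4 * α) * ‖y - x‖ ^ 2 := by
        have : 0 ≤ α / L * (‖f' x‖ - L / (2 * α) * ‖y - x‖) ^ 2 := by positivity
        have e : α / L * (‖f' x‖ - L / (2 * α) * ‖y - x‖) ^ 2 = α / L * ‖f' x‖ ^ 2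
          + L / (4 * α) * ‖y - x‖ ^ 2 - ‖f' x‖ * ‖y - x‖ := by
          field_simp; ring
        linarith
      have h4 : (1 / L - α / L) * ‖f' x‖ ^ 2 - L / (4 * α) * ‖y - x‖ ^ 2 ≤ ⟪f' x, y - u⟫ := by
        rw [hsplit]; linarith
      have h5 := mul_le_mul_of_nonneg_left h4 (by positivity : 0 ≤ 2 * m)
      have h6 : L * m / (2 * α) ≤ k := by
        rw [hk]; exact div_le_div_of_nonneg_right (hLm.trans hγγ) (by positivity)
      have h7 := mul_le_mul_of_nonneg_right h6 hN
      have e : 2 * m * ((1 / L - α / L) * ‖f' x‖ ^ 2 - L / (4 * α) * ‖y - x‖ ^ 2)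
        = 2 * (1 - α) / L * m * ‖f' x‖ ^ 2 - L * m / (2 * α) * ‖y - x‖ ^ 2 := by
        field_simp; ring
      linarith
    have c1 := mul_le_mul_of_nonneg_left o1 hθ0.le
    have c2 := mul_le_mul_of_nonneg_left o2 (by linarith : 0 ≤ 1 - θ)
    have c3 : (θ * γ' + (1 - θ) * k) * ‖y - x‖ ^ 2 ≤ (1 + k) / 2 * ‖y - x‖ ^ 2 := by
      apply mul_le_mul_of_nonneg_right _ hN
      nlinarith
    nlinarith

/-- **Lemma 5.2 (key estimate).** There exist `a, b, c, d, e > 0` (here `d, e` are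
named `d₀, e₀`) such that for all `u ∈ C ∩ dom A`, `z ∈ A u`, `v ∈ N_C(u)` and
`w = z + ∇Φ(u) + v`, the key inequality holds for all sufficiently large `n`. -/
theorem sfbp_key_estimate (d : SFBP H) :
    ∃ a > (0:ℝ), ∃ b > (0:ℝ), ∃ c > (0:ℝ), ∃ d₀ > (0:ℝ), ∃ e₀ > (0:ℝ),
      ∀ u z v, z ∈ d.A u → v ∈ nCone d.C u →
        ∀ᶠ n in Filter.atTop,
          (((1 - a * d.LΦ * d.lam n ^ 2) * ‖d.x (n + 1) - u‖ ^ 2 - ‖d.x n - u‖ ^ 2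
              + b * ‖d.x (n + 1) - d.x n‖ ^ 2
              + c * d.lam n * ‖d.Φ' (d.x (n + 1)) - d.Φ' u‖ ^ 2
              + e₀ * (d.lam n * d.beta n) * ‖d.Ψ₁' (d.x n)‖ ^ 2 : ℝ) : EReal)
            + ((d₀ / 2 * (d.lam n * d.beta n) : ℝ) : EReal) *
                (((d.Ψ₁ (d.x (n + 1)) : ℝ) : EReal) + d.Ψ₂ (d.x (n + 1)))
          ≤ ((d₀ / 2 * (d.lam n * d.beta n) : ℝ) : EReal) *
                (fenchelConj (fun q => ((d.Ψ₁ q : ℝ) : EReal) + d.Ψ₂ q)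
                    ((4 / (d₀ * d.beta n)) • v)
                  - suppFun d.C ((4 / (d₀ * d.beta n)) • v))
            + ((2 * d.lam n * ⟪z + d.Φ' u + v, u - d.x (n + 1)⟫ : ℝ) : EReal) := by
  obtain ⟨γ, hγ, hev⟩ := d.limsupCond
  obtain ⟨θ, hθ0, hθ1, e, he, κ, hκ, hpsi⟩ :=
    aux_psi d.convΨ₁ d.gradΨ₁ d.lipΨ₁ hγ d.minΨ₁ d.Ψ₁nonneg
  obtain ⟨a, ha, c, hc, hphi⟩ := aux_phi d.convΦ d.gradΦ d.lipΦ
    (by linarith : 0 < (1 - κ) / 2)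
  refine ⟨a, ha, (1 - κ) / 2, by linarith, c, hc, 2 * θ, by linarith, e, he, ?_⟩
  intro u z v hz hv
  filter_upwards [hev] with n hn
  obtain ⟨s, hs, w, hw, halg⟩ := d.algo n
  have hl := d.lamPos n
  have hb := d.betaPos n
  obtain ⟨huC, hvC⟩ := hv
  have huC' := huC
  rw [d.Cdef] at huC'
  obtain ⟨hu1, hu2⟩ := huC'
  have hΨ1u : d.Ψ₁ u = 0 := by
    obtain ⟨p, hp⟩ := d.minΨ₁
    have := hu1 p
    linarith [d.Ψ₁nonneg u]
  have hΨ2u : d.Ψ₂ u = 0 := by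
    obtain ⟨p, hp⟩ := d.minΨ₂
    exact le_antisymm (hp ▸ hu2 p) (d.Ψ₂nonneg u)
  have P1 := hpsi (d.x n) (d.x (n + 1)) u (d.lam n * d.beta n) (by positivity) hn hΨ1u
  have P2 := hphi (d.x n) (d.x (n + 1)) u (d.lam n) hl
  have P3 := d.maxmonA.1 _ _ _ _ hs hz
  have hwu := hw u
  rw [hΨ2u] at hwu
  have hnn := d.Ψ₂nonneg (d.x (n + 1))
  generalize d.x (n + 1) = y at *
  generalize d.x n = x at *
  generalize d.lam n = l at *
  generalize d.beta n = β at *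
  obtain ⟨ψ, hψ⟩ : ∃ ψ : ℝ, d.Ψ₂ y = (ψ : EReal) := by
    refine ⟨(d.Ψ₂ y).toReal, (EReal.coe_toReal ?_ ?_).symm⟩
    · intro h
      rw [h] at hwu
      simp at hwu
    · exact d.properΨ₂.2.1 y
  rw [hψ] at hwu hnn ⊢
  have hψ0 : 0 ≤ ψ := by exact_mod_cast hnn
  have P4 : ψ + ⟪w, u - y⟫ ≤ 0 := by exact_mod_cast hwu
  -- the conjugate
  have hF : ((⟪y, (4 / (2 * θ * β)) • v⟫ - (d.Ψ₁ y + ψ) : ℝ) : EReal) ≤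
      fenchelConj (fun q => ((d.Ψ₁ q : ℝ) : EReal) + d.Ψ₂ q) ((4 / (2 * θ * β)) • v) := by
    refine le_trans (le_of_eq ?_) (le_iSup _ y)
    simp only [hψ]
    push_cast
    rfl
  have hS : suppFun d.C ((4 / (2 * θ * β)) • v) ≤ ((⟪(4 / (2 * θ * β)) • v, u⟫ : ℝ) : EReal) := by
    refine iSup_le fun q => ?_
    have h1 := hvC q q.2
    rw [inner_sub_right] at h1
    rw [EReal.coe_le_coe_iff, real_inner_smul_left, real_inner_smul_left]
    exact mul_le_mul_of_nonneg_left (by linarith) (by positivity)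
  have hFS := EReal.sub_le_sub hF hS
  have hmul := mul_le_mul_of_nonneg_left hFS
    (by exact_mod_cast (by positivity : 0 ≤ 2 * θ / 2 * (l * β)) :
      (0 : EReal) ≤ ((2 * θ / 2 * (l * β) : ℝ) : EReal))
  refine le_trans ?_ (add_le_add_left hmul _)
  norm_cast
  rw [real_inner_smul_right, real_inner_smul_left, real_inner_comm v y]
  have E1 : 2 * ⟪x - y, y - u⟫ = ‖x - u‖ ^ 2 - ‖y - x‖ ^ 2 - ‖y - u‖ ^ 2 := by
    have : x - u = (x - y) + (y - u) := by abel
    rw [this, norm_add_sq_real, norm_sub_rev y x]; ring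
  rw [halg, real_inner_smul_left, inner_add_left, inner_add_left, inner_add_left,
    real_inner_smul_left, real_inner_smul_left] at E1
  rw [inner_sub_left] at P2 P3
  have E2 : 2 * θ / 2 * (l * β) * (4 / (2 * θ * β) * ⟪v, y⟫ - (d.Ψ₁ y + ψ)
      - 4 / (2 * θ * β) * ⟪v, u⟫) = 2 * l * ⟪v, y - u⟫ - θ * (l * β) * (d.Ψ₁ y + ψ) := by
    rw [inner_sub_right]; field_simp; ring
  rw [E2, ← neg_sub y u, inner_neg_right, inner_add_left, inner_add_left]
  rw [← neg_sub y u, inner_neg_right] at P4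
  have Q3 := mul_le_mul_of_nonneg_left P3 (by positivity : 0 ≤ 2 * l)
  have Q4 := mul_le_mul_of_nonneg_left P4 (by positivity : 0 ≤ 2 * (l * β))
  have Q5 : 0 ≤ (1 - θ) * (l * β * ψ) := mul_nonneg (by linarith) (by positivity)
  nlinarith
end
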